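/- arXiv:1109.1287 — 2 statements merged into one kernel-verified Lean document; each statement's English description precedes it below -/
import Mathlib

section
/- For every b with 0 < b < 1, lim_{R→∞} M₀(b,R)/R³ = g(b); that is, the thermodynamic limit of the three-dimensional Ginzburg–Landau ground state energy per unit volume equals the two-dimensional limiting function g(b). -/
open MeasureTheory Filter Set

noncomputable section

/-- The canonical 2D magnetic potential `A₀(x) = (-x₂/2, x₁/2)`. -/
def A0 (x : ℝ × ℝ) : ℝ × ℝ := (-x.2 / 2, x.1 / 2)

/-- The open square `K_R = (-R/2, R/2) × (-R/2, R/2)` in `ℝ²`. -/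
def KR (R : ℝ) : Set (ℝ × ℝ) := Ioo (-R/2) (R/2) ×ˢ Ioo (-R/2) (R/2)

/-- First component of the magnetic gradient `(∇ - iA₀)u`. -/
def D1 (u : ℝ × ℝ → ℂ) (x : ℝ × ℝ) : ℂ :=
  fderiv ℝ u x (1, 0) - Complex.I * ((A0 x).1 : ℂ) * u x

/-- Second component of the magnetic gradient `(∇ - iA₀)u`. -/
def D2 (u : ℝ × ℝ → ℂ) (x : ℝ × ℝ) : ℂ :=
  fderiv ℝ u x (0, 1) - Complex.I * ((A0 x).2 : ℂ) * u x

/-- The two-dimensional Ginzburg–Landau energy `G_{b,K_R}(u)`. -/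
def G2 (b R : ℝ) (u : ℝ × ℝ → ℂ) : ℝ :=
  ∫ x in KR R, (b * (‖D1 u x‖ ^ 2 + ‖D2 u x‖ ^ 2) - ‖u x‖ ^ 2 + (1/2) * ‖u x‖ ^ 4)

/-- `m₀(b,R)`: the ground state energy of `G_{b,K_R}` with Dirichlet boundary conditions,
realized (by density) as the infimum over smooth functions compactly supported in `K_R`. -/
def m0 (b R : ℝ) : ℝ :=
  sInf {E : ℝ | ∃ u : ℝ × ℝ → ℂ, ContDiff ℝ (⊤ : ℕ∞) u ∧ HasCompactSupport u ∧
    tsupport u ⊆ KR R ∧ E = G2 b R u}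

/-- The magnetic periodicity conditions defining the space `E_R`. -/
def MagPeriodic (R : ℝ) (u : ℝ × ℝ → ℂ) : Prop :=
  ∀ x : ℝ × ℝ,
    u (x.1 + R, x.2) = Complex.exp (Complex.I * (R * x.2 / 2)) * u x ∧
    u (x.1, x.2 + R) = Complex.exp (-(Complex.I * (R * x.1 / 2))) * u x

/-- `m_p(b,R)`: the ground state energy of `G_{b,K_R}` over the magnetically periodic space
`E_R`, realized (by elliptic regularity/density) over smooth magnetic periodic functions. -/
def mp (b R : ℝ) : ℝ :=
  sInf {E : ℝ | ∃ u : ℝ × ℝ → ℂ, ContDiff ℝ (⊤ : ℕ∞) u ∧ MagPeriodic R u ∧ E = G2 b R u}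

/-- The lowest Landau band equation `(∂₁ + i∂₂ + (1/2)(x₁ + ix₂))u = 0`. -/
def LLL (u : ℝ × ℝ → ℂ) : Prop :=
  ∀ x : ℝ × ℝ,
    fderiv ℝ u x (1, 0) + Complex.I * fderiv ℝ u x (0, 1)
      + (1/2 : ℂ) * ((x.1 : ℂ) + Complex.I * (x.2 : ℂ)) * u x = 0

/-- The Abrikosov energy `F_R(v) = ∫_{K_R} (-|v|² + (1/2)|v|⁴)`. -/
def FAb (R : ℝ) (v : ℝ × ℝ → ℂ) : ℝ :=
  ∫ x in KR R, (-‖v x‖ ^ 2 + (1/2) * ‖v x‖ ^ 4)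

/-- `c(R)`: the minimal Abrikosov energy over the lowest Landau band `L_R`. -/
def cAb (R : ℝ) : ℝ :=
  sInf {E : ℝ | ∃ u : ℝ × ℝ → ℂ, ContDiff ℝ (⊤ : ℕ∞) u ∧ MagPeriodic R u ∧ LLL u ∧ E = FAb R u}

/-- The thermodynamic limit function `g(b) = lim_{R→∞} m₀(b,R)/R²`. -/
def gfun (b : ℝ) : ℝ := limUnder atTop (fun R : ℝ => m0 b R / R ^ 2)

/-- The canonical 3D magnetic potential `F(x) = (-x₂/2, x₁/2, 0)`. -/
def Fpot (x : ℝ × ℝ × ℝ) : ℝ × ℝ × ℝ := (-x.2.1 / 2, x.1 / 2, 0)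

/-- The open cube `Q_R = (-R/2, R/2)³` in `ℝ³`. -/
def QR (R : ℝ) : Set (ℝ × ℝ × ℝ) :=
  Ioo (-R/2) (R/2) ×ˢ Ioo (-R/2) (R/2) ×ˢ Ioo (-R/2) (R/2)

/-- First component of the 3D magnetic gradient `(∇ - iF)u`. -/
def DD1 (u : ℝ × ℝ × ℝ → ℂ) (x : ℝ × ℝ × ℝ) : ℂ :=
  fderiv ℝ u x (1, 0, 0) - Complex.I * ((Fpot x).1 : ℂ) * u x

/-- Second component of the 3D magnetic gradient `(∇ - iF)u`. -/
def DD2 (u : ℝ × ℝ × ℝ → ℂ) (x : ℝ × ℝ × ℝ) : ℂ :=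
  fderiv ℝ u x (0, 1, 0) - Complex.I * ((Fpot x).2.1 : ℂ) * u x

/-- Third component of the 3D magnetic gradient `(∇ - iF)u`. -/
def DD3 (u : ℝ × ℝ × ℝ → ℂ) (x : ℝ × ℝ × ℝ) : ℂ :=
  fderiv ℝ u x (0, 0, 1) - Complex.I * ((Fpot x).2.2 : ℂ) * u x

/-- The three-dimensional Ginzburg–Landau energy `F³ᴰ_{b,Q_R}(u)`. -/
def G3 (b R : ℝ) (u : ℝ × ℝ × ℝ → ℂ) : ℝ :=
  ∫ x in QR R, (b * (‖DD1 u x‖ ^ 2 + ‖DD2 u x‖ ^ 2 + ‖DD3 u x‖ ^ 2)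
    - ‖u x‖ ^ 2 + (1/2) * ‖u x‖ ^ 4)

/-- `M₀(b,R)`: the 3D ground state energy with Dirichlet boundary conditions. -/
def M0 (b R : ℝ) : ℝ :=
  sInf {E : ℝ | ∃ u : ℝ × ℝ × ℝ → ℂ, ContDiff ℝ (⊤ : ℕ∞) u ∧ HasCompactSupport u ∧
    tsupport u ⊆ QR R ∧ E = G3 b R u}

end

noncomputable section

/-- The two-dimensional Ginzburg–Landau energy density. -/
def dens2 (b : ℝ) (u : ℝ × ℝ → ℂ) (x : ℝ × ℝ) : ℝ :=
  b * (‖D1 u x‖ ^ 2 + ‖D2 u x‖ ^ 2) - ‖u x‖ ^ 2 + (1/2) * ‖u x‖ ^ 4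

/-- The three-dimensional Ginzburg–Landau energy density. -/
def dens3 (b : ℝ) (u : ℝ × ℝ × ℝ → ℂ) (x : ℝ × ℝ × ℝ) : ℝ :=
  b * (‖DD1 u x‖ ^ 2 + ‖DD2 u x‖ ^ 2 + ‖DD3 u x‖ ^ 2) - ‖u x‖ ^ 2 + (1/2) * ‖u x‖ ^ 4

/-- The magnetic translate of `u` by the vector `a`. -/
def magTranslate (a : ℝ × ℝ) (u : ℝ × ℝ → ℂ) (x : ℝ × ℝ) : ℂ :=
  Complex.exp (Complex.I * (((A0 a).1 * x.1 + (A0 a).2 * x.2 : ℝ) : ℂ)) * u (x - a)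

/-- A smooth cutoff, equal to `1` at distance at least `3/2` from the boundary of
`(-R/2, R/2)` and to `0` at distance at most `1/2`. -/
def cutoff (R t : ℝ) : ℝ :=
  Real.smoothTransition (R / 2 - 1 / 2 - t) * Real.smoothTransition (t + (R / 2 - 1 / 2))

end

section Density

variable {b R : ℝ}

theorem dens2_eq_zero {u : ℝ × ℝ → ℂ} {x : ℝ × ℝ} (hx : x ∉ tsupport u) : dens2 b u x = 0 := by
  have h0 : u x = 0 := image_eq_zero_of_notMem_tsupport hx
  have h1 : fderiv ℝ u x = 0 := by
    by_contra h
    exact hx (support_fderiv_subset ℝ h)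
  simp [dens2, D1, D2, h0, h1]

theorem dens3_eq_zero {u : ℝ × ℝ × ℝ → ℂ} {x : ℝ × ℝ × ℝ} (hx : x ∉ tsupport u) :
    dens3 b u x = 0 := by
  have h0 : u x = 0 := image_eq_zero_of_notMem_tsupport hx
  have h1 : fderiv ℝ u x = 0 := by
    by_contra h
    exact hx (support_fderiv_subset ℝ h)
  simp [dens3, DD1, DD2, DD3, h0, h1]

theorem G2_eq_integral {u : ℝ × ℝ → ℂ} (hu : tsupport u ⊆ KR R) :
    G2 b R u = ∫ x, dens2 b u x :=
  setIntegral_eq_integral_of_forall_compl_eq_zero fun _ hx => dens2_eq_zero fun h => hx (hu h)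

theorem G3_eq_integral {u : ℝ × ℝ × ℝ → ℂ} (hu : tsupport u ⊆ QR R) :
    G3 b R u = ∫ x, dens3 b u x :=
  setIntegral_eq_integral_of_forall_compl_eq_zero fun _ hx => dens3_eq_zero fun h => hx (hu h)

theorem integrable_dens2 {u : ℝ × ℝ → ℂ} (hu : ContDiff ℝ (⊤ : ℕ∞) u)
    (hc : HasCompactSupport u) : Integrable (dens2 b u) := by
  have h0 := hu.continuous
  have h1 : Continuous (fderiv ℝ u) := hu.continuous_fderiv (by simp)
  refine Continuous.integrable_of_hasCompactSupport ?_
    (HasCompactSupport.intro hc fun x hx => dens2_eq_zero hx)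
  unfold dens2 D1 D2 A0
  fun_prop

theorem integrable_dens3 {u : ℝ × ℝ × ℝ → ℂ} (hu : ContDiff ℝ (⊤ : ℕ∞) u)
    (hc : HasCompactSupport u) : Integrable (dens3 b u) := by
  have h0 := hu.continuous
  have h1 : Continuous (fderiv ℝ u) := hu.continuous_fderiv (by simp)
  refine Continuous.integrable_of_hasCompactSupport ?_
    (HasCompactSupport.intro hc fun x hx => dens3_eq_zero hx)
  unfold dens3 DD1 DD2 DD3 Fpot
  fun_prop

theorem dens2_add {u v : ℝ × ℝ → ℂ} (hu : Differentiable ℝ u) (hv : Differentiable ℝ v)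
    (huv : Disjoint (tsupport u) (tsupport v)) (x : ℝ × ℝ) :
    dens2 b (u + v) x = dens2 b u x + dens2 b v x := by
  have key : ∀ {u v : ℝ × ℝ → ℂ}, Differentiable ℝ u → Differentiable ℝ v → x ∉ tsupport u →
      dens2 b (u + v) x = dens2 b u x + dens2 b v x := by
    intro u v hu hv hx
    have h0 : u x = 0 := image_eq_zero_of_notMem_tsupport hx
    have h1 : fderiv ℝ u x = 0 := by
      by_contra h
      exact hx (support_fderiv_subset ℝ h)
    rw [dens2_eq_zero hx]
    simp [dens2, D1, D2, h0, h1, fderiv_add (hu x) (hv x)]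
  by_cases hx : x ∈ tsupport u
  · rw [add_comm u v, key hv hu (huv.notMem_of_mem_left hx), add_comm]
  · exact key hu hv hx

theorem tsupport_add_subset {u v : ℝ × ℝ → ℂ} :
    tsupport (u + v) ⊆ tsupport u ∪ tsupport v := by
  rw [tsupport, tsupport, tsupport, ← closure_union]
  exact closure_mono (Function.support_add u v)

theorem sq_norm_sub_two_le_dens2 (hb : 0 ≤ b) (u : ℝ × ℝ → ℂ) (x : ℝ × ℝ) :
    ‖u x‖ ^ 2 - 2 ≤ dens2 b u x := by
  have : 0 ≤ b * (‖D1 u x‖ ^ 2 + ‖D2 u x‖ ^ 2) := by positivity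
  unfold dens2
  nlinarith [sq_nonneg (‖u x‖ ^ 2 - 2)]

theorem volume_KR (hR : 0 ≤ R) : volume.real (KR R) = R ^ 2 := by
  have h : volume.real (Ioo (-R / 2) (R / 2)) = R := by
    rw [Real.volume_real_Ioo_of_le (by linarith)]; ring
  rw [KR, Measure.volume_eq_prod, measureReal_prod_prod, h]; ring

theorem hasCompactSupport_of_tsupport_subset_KR {u : ℝ × ℝ → ℂ} (hu : tsupport u ⊆ KR R) :
    HasCompactSupport u :=
  (isCompact_Icc.prod isCompact_Icc).of_isClosed_subset (isClosed_tsupport u)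
    (hu.trans (prod_mono Ioo_subset_Icc_self Ioo_subset_Icc_self))

/-- The `L²` norm is controlled by the energy. -/
theorem integral_sq_norm_le (hb : 0 ≤ b) (hR : 0 ≤ R) {u : ℝ × ℝ → ℂ}
    (hu : ContDiff ℝ (⊤ : ℕ∞) u) (hs : tsupport u ⊆ KR R) :
    ∫ x, ‖u x‖ ^ 2 ≤ G2 b R u + 2 * R ^ 2 := by
  have hc := hasCompactSupport_of_tsupport_subset_KR hs
  have hfin : volume (KR R) ≠ ⊤ := by
    rw [KR, Measure.volume_eq_prod, Measure.prod_prod]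
    simp [ENNReal.mul_eq_top]
  have hi : Integrable (fun x => ‖u x‖ ^ 2) := by
    refine Continuous.integrable_of_hasCompactSupport (by have := hu.continuous; fun_prop)
      (HasCompactSupport.intro hc fun x hx => ?_)
    simp [image_eq_zero_of_notMem_tsupport hx]
  have h1 : ∫ x, ‖u x‖ ^ 2 = ∫ x in KR R, ‖u x‖ ^ 2 :=
    (setIntegral_eq_integral_of_forall_compl_eq_zero fun x hx => by
      simp [image_eq_zero_of_notMem_tsupport fun h => hx (hs h)]).symm
  have h2 : ∫ x in KR R, (‖u x‖ ^ 2 - 2) ≤ G2 b R u :=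
    integral_mono (hi.integrableOn.sub (integrableOn_const hfin))
      (integrable_dens2 hu hc).integrableOn fun x => sq_norm_sub_two_le_dens2 hb u x
  rw [integral_sub hi.integrableOn (integrableOn_const hfin), setIntegral_const,
    volume_KR hR, ← h1] at h2
  simp only [smul_eq_mul] at h2
  linarith

end Density

section Planar

variable {b R : ℝ}

theorem bddBelow_G2 (hb : 0 ≤ b) (hR : 0 ≤ R) :
    BddBelow {E : ℝ | ∃ u : ℝ × ℝ → ℂ, ContDiff ℝ (⊤ : ℕ∞) u ∧ HasCompactSupport u ∧
      tsupport u ⊆ KR R ∧ E = G2 b R u} := by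
  refine ⟨-(2 * R ^ 2), ?_⟩
  rintro _ ⟨u, hu, -, hs, rfl⟩
  have h := integral_sq_norm_le hb hR hu hs
  have : 0 ≤ ∫ x, ‖u x‖ ^ 2 := integral_nonneg fun _ => by positivity
  linarith

theorem m0_le (hb : 0 ≤ b) (hR : 0 ≤ R) {u : ℝ × ℝ → ℂ} (hu : ContDiff ℝ (⊤ : ℕ∞) u)
    (hs : tsupport u ⊆ KR R) : m0 b R ≤ ∫ x, dens2 b u x :=
  csInf_le (bddBelow_G2 hb hR)
    ⟨u, hu, hasCompactSupport_of_tsupport_subset_KR hs, hs, (G2_eq_integral hs).symm⟩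

theorem m0_nonpos (hb : 0 ≤ b) (hR : 0 ≤ R) : m0 b R ≤ 0 := by
  have h := m0_le hb hR (u := 0) contDiff_const (by simp [tsupport])
  simpa [dens2, D1, D2] using h

theorem exists_energy_lt_m0_add {ε : ℝ} (hε : 0 < ε) :
    ∃ u : ℝ × ℝ → ℂ, ContDiff ℝ (⊤ : ℕ∞) u ∧ tsupport u ⊆ KR R ∧
      ∫ x, dens2 b u x < m0 b R + ε := by
  have hne : {E : ℝ | ∃ u : ℝ × ℝ → ℂ, ContDiff ℝ (⊤ : ℕ∞) u ∧ HasCompactSupport u ∧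
      tsupport u ⊆ KR R ∧ E = G2 b R u}.Nonempty :=
    ⟨_, 0, contDiff_const, HasCompactSupport.zero, by simp [tsupport], rfl⟩
  obtain ⟨_, ⟨u, hu, -, hs, rfl⟩, hlt⟩ := Real.lt_sInf_add_pos hne hε
  exact ⟨u, hu, hs, by rwa [← G2_eq_integral hs]⟩

theorem KR_mono {R' : ℝ} (h : R ≤ R') : KR R ⊆ KR R' :=
  prod_mono (Ioo_subset_Ioo (by linarith) (by linarith))
    (Ioo_subset_Ioo (by linarith) (by linarith))

theorem contDiff_magTranslate (a : ℝ × ℝ) {u : ℝ × ℝ → ℂ} (hu : ContDiff ℝ (⊤ : ℕ∞) u) :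
    ContDiff ℝ (⊤ : ℕ∞) (magTranslate a u) := by
  unfold magTranslate
  refine ContDiff.mul (ContDiff.cexp (contDiff_const.mul ?_))
    (hu.comp (contDiff_id.sub contDiff_const))
  exact Complex.ofRealCLM.contDiff.comp
    ((contDiff_const.mul contDiff_fst).add (contDiff_const.mul contDiff_snd))

theorem tsupport_magTranslate (a : ℝ × ℝ) (u : ℝ × ℝ → ℂ) :
    tsupport (magTranslate a u) ⊆ (fun x => x - a) ⁻¹' tsupport u := by
  refine closure_minimal (fun x hx => subset_closure ?_)
    ((isClosed_tsupport u).preimage (by fun_prop))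
  exact right_ne_zero_of_mul (Function.mem_support.mp hx)

theorem fderiv_magTranslate (a : ℝ × ℝ) {u : ℝ × ℝ → ℂ} (hu : Differentiable ℝ u)
    (x v : ℝ × ℝ) : fderiv ℝ (magTranslate a u) x v =
      Complex.exp (Complex.I * (((A0 a).1 * x.1 + (A0 a).2 * x.2 : ℝ) : ℂ)) *
        (fderiv ℝ u (x - a) v +
          Complex.I * (((A0 a).1 * v.1 + (A0 a).2 * v.2 : ℝ) : ℂ) * u (x - a)) := by
  have h1 : HasFDerivAt (fun y => u (y - a)) (fderiv ℝ u (x - a)) x := by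
    have h := ((hu (x - a)).hasFDerivAt).comp x ((hasFDerivAt_id x).sub_const a)
    rw [ContinuousLinearMap.comp_id] at h
    exact h
  have h2 : HasFDerivAt (fun y : ℝ × ℝ => (A0 a).1 * y.1 + (A0 a).2 * y.2)
      ((A0 a).1 • ContinuousLinearMap.fst ℝ ℝ ℝ + (A0 a).2 • ContinuousLinearMap.snd ℝ ℝ ℝ) x :=
    (hasFDerivAt_fst.const_mul _).add (hasFDerivAt_snd.const_mul _)
  have h3 := (((Complex.ofRealCLM.hasFDerivAt.comp x h2).const_mul Complex.I).cexp).mul h1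
  have h4 : HasFDerivAt (magTranslate a u) _ x := h3
  rw [h4.fderiv]
  simp
  ring

theorem dens2_magTranslate (a : ℝ × ℝ) {u : ℝ × ℝ → ℂ} (hu : Differentiable ℝ u) (x : ℝ × ℝ) :
    dens2 b (magTranslate a u) x = dens2 b u (x - a) := by
  have hexp : ∀ t : ℝ, ‖Complex.exp (Complex.I * (t : ℂ))‖ = 1 := fun t => by
    rw [mul_comm, Complex.norm_exp_ofReal_mul_I]
  have e1 : ‖D1 (magTranslate a u) x‖ = ‖D1 u (x - a)‖ := by
    rw [← one_mul ‖D1 u (x - a)‖, ← hexp ((A0 a).1 * x.1 + (A0 a).2 * x.2), ← norm_mul]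
    congr 1
    rw [D1, D1, fderiv_magTranslate a hu, magTranslate]
    simp [A0]
    ring
  have e2 : ‖D2 (magTranslate a u) x‖ = ‖D2 u (x - a)‖ := by
    rw [← one_mul ‖D2 u (x - a)‖, ← hexp ((A0 a).1 * x.1 + (A0 a).2 * x.2), ← norm_mul]
    congr 1
    rw [D2, D2, fderiv_magTranslate a hu, magTranslate]
    simp [A0]
    ring
  have e3 : ‖magTranslate a u x‖ = ‖u (x - a)‖ := by
    rw [magTranslate, norm_mul, hexp, one_mul]
  rw [dens2, dens2, e1, e2, e3]

/-- Superposing magnetic translates with disjoint supports multiplies the energy. -/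
theorem exists_superposition {u : ℝ × ℝ → ℂ} (hu : ContDiff ℝ (⊤ : ℕ∞) u)
    (hc : HasCompactSupport u) {ι : Type*} (s : Finset ι) (a : ι → ℝ × ℝ)
    (hd : Pairwise fun i j => Disjoint ((fun x => x - a i) ⁻¹' tsupport u)
      ((fun x => x - a j) ⁻¹' tsupport u)) :
    ∃ v : ℝ × ℝ → ℂ, ContDiff ℝ (⊤ : ℕ∞) v ∧ HasCompactSupport v ∧
      tsupport v ⊆ ⋃ i ∈ s, (fun x => x - a i) ⁻¹' tsupport u ∧
      ∫ x, dens2 b v x = s.card * ∫ x, dens2 b u x := by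
  classical
  induction s using Finset.induction_on with
  | empty =>
    exact ⟨0, contDiff_const, HasCompactSupport.zero, by simp [tsupport],
      by simp [dens2, D1, D2]⟩
  | insert i s hi ih =>
    obtain ⟨v, hv, hvc, hvs, hve⟩ := ih
    set w := magTranslate (a i) u with hw
    have hwd : ContDiff ℝ (⊤ : ℕ∞) w := contDiff_magTranslate _ hu
    have hws : tsupport w ⊆ (fun x => x - a i) ⁻¹' tsupport u := tsupport_magTranslate _ _
    have hwc : HasCompactSupport w := by
      refine IsCompact.of_isClosed_subset ?_ (isClosed_tsupport w) hws
      exact (Homeomorph.subRight (a i)).isCompact_preimage.mpr hc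
    have hwv : Disjoint (tsupport w) (tsupport v) := by
      refine Disjoint.mono hws hvs ?_
      simp only [disjoint_iUnion_right]
      intro j hj
      exact hd fun h => hi (h ▸ hj)
    refine ⟨w + v, hwd.add hv, hwc.add hvc, ?_, ?_⟩
    · rw [Finset.set_biUnion_insert]
      exact tsupport_add_subset.trans (union_subset_union hws hvs)
    · simp only [dens2_add (hwd.differentiable (by simp)) (hv.differentiable (by simp)) hwv]
      rw [integral_add (integrable_dens2 hwd hwc) (integrable_dens2 hv hvc), hve,
        Finset.card_insert_of_notMem hi]
      simp only [hw, dens2_magTranslate (a i) (hu.differentiable (by simp))]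
      rw [integral_sub_right_eq_self (fun x => dens2 b u x) (a i)]
      push_cast
      ring

theorem disjoint_translated_Ioo (hR : 0 < R) {n p q : ℕ} {t : ℝ} (h : p ≠ q)
    (hp : t - R * (p - (n - 1) / 2) ∈ Ioo (-R / 2) (R / 2))
    (hq : t - R * (q - (n - 1) / 2) ∈ Ioo (-R / 2) (R / 2)) : False := by
  wlog hlt : p < q generalizing p q
  · exact this h.symm hq hp (by omega)
  have : (p : ℝ) + 1 ≤ q := by exact_mod_cast hlt
  have := mul_le_mul_of_nonneg_left this hR.le
  have h1 := hp.2
  have h2 := hq.1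
  nlinarith

theorem translated_Ioo_subset (hR : 0 < R) {n p : ℕ} {t : ℝ} (h : p < n)
    (hp : t - R * (p - (n - 1) / 2) ∈ Ioo (-R / 2) (R / 2)) :
    t ∈ Ioo (-(n * R) / 2) (n * R / 2) := by
  have : (p : ℝ) + 1 ≤ n := by exact_mod_cast h
  have := mul_le_mul_of_nonneg_left this hR.le
  have := mul_nonneg hR.le (Nat.cast_nonneg (α := ℝ) p)
  have h1 := hp.1
  have h2 := hp.2
  constructor <;> nlinarith

theorem m0_le_sq_mul (hb : 0 ≤ b) (hR : 0 < R) {R' : ℝ} (n : ℕ) (hn : n * R ≤ R') :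
    m0 b R' ≤ n ^ 2 * m0 b R := by
  have hR' : 0 ≤ R' := le_trans (by positivity) hn
  have key : ∀ ε > 0, m0 b R' ≤ n ^ 2 * (m0 b R + ε) := by
    intro ε hε
    obtain ⟨u, hu, hs, hE⟩ := exists_energy_lt_m0_add (b := b) (R := R) hε
    let a : ℕ × ℕ → ℝ × ℝ := fun p =>
      (R * ((p.1 : ℝ) - ((n : ℝ) - 1) / 2), R * ((p.2 : ℝ) - ((n : ℝ) - 1) / 2))
    obtain ⟨v, hv, -, hvs, hve⟩ := exists_superposition (b := b) hu
      (hasCompactSupport_of_tsupport_subset_KR hs)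
      (Finset.range n ×ˢ Finset.range n) a (by
        intro p q hpq
        refine disjoint_left.mpr fun x hx hy => ?_
        have hx := hs hx
        have hy := hs hy
        apply hpq
        ext
        · by_contra h
          exact disjoint_translated_Ioo hR h hx.1 hy.1
        · by_contra h
          exact disjoint_translated_Ioo hR h hx.2 hy.2)
    have hvK : tsupport v ⊆ KR R' := by
      refine hvs.trans (iUnion₂_subset fun p hp x hx => KR_mono hn ?_)
      rw [Finset.mem_product, Finset.mem_range, Finset.mem_range] at hp
      have hx := hs hx
      exact ⟨translated_Ioo_subset hR hp.1 hx.1, translated_Ioo_subset hR hp.2 hx.2⟩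
    have h := m0_le hb hR' hv hvK
    rw [hve] at h
    have hcard : ((Finset.range n ×ˢ Finset.range n).card : ℝ) = (n : ℝ) ^ 2 := by
      simp [sq]
    rw [hcard] at h
    exact h.trans (by gcongr)
  have hlim : Tendsto (fun ε : ℝ => (n : ℝ) ^ 2 * (m0 b R + ε)) (nhdsWithin 0 (Ioi 0))
      (nhds ((n : ℝ) ^ 2 * (m0 b R + 0))) :=
    (Continuous.tendsto (by fun_prop) 0).mono_left nhdsWithin_le_nhds
  rw [add_zero] at hlim
  exact ge_of_tendsto hlim (eventually_mem_nhdsWithin.mono key)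

theorem neg_two_le_m0_div (hb : 0 ≤ b) (hR : 0 < R) : -2 ≤ m0 b R / R ^ 2 := by
  rw [le_div_iff₀ (by positivity)]
  refine le_csInf ⟨_, 0, contDiff_const, HasCompactSupport.zero, by simp [tsupport], rfl⟩ ?_
  rintro _ ⟨u, hu, -, hs, rfl⟩
  have h := integral_sq_norm_le hb hR.le hu hs
  have : 0 ≤ ∫ x, ‖u x‖ ^ 2 := integral_nonneg fun _ => by positivity
  linarith

/-- The two-dimensional thermodynamic limit exists. -/
theorem tendsto_m0_div (hb : 0 ≤ b) :
    Tendsto (fun R : ℝ => m0 b R / R ^ 2) atTop (nhds (gfun b)) := by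
  refine tendsto_nhds_limUnder ⟨sInf ((fun R : ℝ => m0 b R / R ^ 2) '' Ioi 0), ?_⟩
  have hbdd : BddBelow ((fun R : ℝ => m0 b R / R ^ 2) '' Ioi 0) := by
    refine ⟨-2, ?_⟩
    rintro _ ⟨R, hR, rfl⟩
    exact neg_two_le_m0_div hb hR
  refine tendsto_order.mpr ⟨fun c hc => ?_, fun c hc => ?_⟩
  · filter_upwards [eventually_gt_atTop 0] with R hR
    exact hc.trans_le (csInf_le hbdd ⟨R, hR, rfl⟩)
  · obtain ⟨_, ⟨R₀, hR₀, rfl⟩, hlt⟩ :=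
      exists_lt_of_csInf_lt (Set.Nonempty.image _ nonempty_Ioi) hc
    have hR₀ : 0 < R₀ := hR₀
    have hlim : Tendsto (fun R : ℝ => ((⌊R₀⁻¹ * R⌋₊ : ℝ) / R) ^ 2 * m0 b R₀) atTop
        (nhds (R₀⁻¹ ^ 2 * m0 b R₀)) :=
      ((tendsto_nat_floor_mul_div_atTop (inv_nonneg.mpr hR₀.le)).pow 2).mul_const _
    have hlt' : R₀⁻¹ ^ 2 * m0 b R₀ < c :=
      calc R₀⁻¹ ^ 2 * m0 b R₀ = m0 b R₀ / R₀ ^ 2 := by field_simp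
        _ < c := hlt
    filter_upwards [hlim.eventually_lt_const hlt', eventually_gt_atTop 0] with R h1 hR
    refine lt_of_le_of_lt ?_ h1
    have hn : (⌊R₀⁻¹ * R⌋₊ : ℝ) * R₀ ≤ R := by
      have := Nat.floor_le (show 0 ≤ R₀⁻¹ * R by positivity)
      calc _ ≤ R₀⁻¹ * R * R₀ := by gcongr
        _ = R := by field_simp
    rw [div_pow, div_mul_eq_mul_div]
    gcongr
    exact m0_le_sq_mul hb hR₀ _ hn

end Planar

section Cutoff

theorem contDiff_cutoff (R : ℝ) : ContDiff ℝ (⊤ : ℕ∞) (cutoff R) :=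
  (Real.smoothTransition.contDiff.comp (contDiff_const.sub contDiff_id)).mul
    (Real.smoothTransition.contDiff.comp (contDiff_id.add contDiff_const))

theorem cutoff_nonneg (R t : ℝ) : 0 ≤ cutoff R t :=
  mul_nonneg (Real.smoothTransition.nonneg _) (Real.smoothTransition.nonneg _)

theorem cutoff_le_one (R t : ℝ) : cutoff R t ≤ 1 :=
  mul_le_one₀ (Real.smoothTransition.le_one _) (Real.smoothTransition.nonneg _)
    (Real.smoothTransition.le_one _)

theorem tsupport_cutoff_subset (R : ℝ) :
    tsupport (cutoff R) ⊆ Icc (-R / 2 + 1 / 2) (R / 2 - 1 / 2) := by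
  refine closure_minimal (fun t ht => ?_) isClosed_Icc
  by_contra h
  rw [mem_Icc, not_and_or, not_le, not_le] at h
  apply ht
  rcases h with h | h
  · rw [cutoff, Real.smoothTransition.zero_of_nonpos (x := t + (R / 2 - 1 / 2)) (by linarith),
      mul_zero]
  · rw [cutoff, Real.smoothTransition.zero_of_nonpos (x := R / 2 - 1 / 2 - t) (by linarith),
      zero_mul]

theorem hasCompactSupport_cutoff (R : ℝ) : HasCompactSupport (cutoff R) :=
  isCompact_Icc.of_isClosed_subset (isClosed_tsupport _) (tsupport_cutoff_subset R)

theorem integrable_cutoff_sq (R : ℝ) : Integrable (fun t => cutoff R t ^ 2) := by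
  refine Continuous.integrable_of_hasCompactSupport ((contDiff_cutoff R).continuous.pow 2)
    (HasCompactSupport.intro (hasCompactSupport_cutoff R) fun t ht => ?_)
  rw [image_eq_zero_of_notMem_tsupport ht, zero_pow two_ne_zero]

theorem integrable_deriv_cutoff_sq (R : ℝ) : Integrable (fun t => deriv (cutoff R) t ^ 2) := by
  refine Continuous.integrable_of_hasCompactSupport
    (((contDiff_cutoff R).continuous_deriv (by simp)).pow 2)
    (HasCompactSupport.intro (hasCompactSupport_cutoff R) fun t ht => ?_)
  have : deriv (cutoff R) t = 0 := by
    by_contra h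
    exact ht (support_deriv_subset h)
  rw [this, zero_pow two_ne_zero]

theorem le_integral_cutoff_sq {R : ℝ} (hR : 3 ≤ R) : R - 3 ≤ ∫ t, cutoff R t ^ 2 := by
  have h1 : ∫ _ in Icc (-R / 2 + 3 / 2) (R / 2 - 3 / 2), (1 : ℝ) = R - 3 := by
    rw [setIntegral_const, Real.volume_real_Icc_of_le (by linarith)]
    simp
    ring
  rw [← h1]
  refine le_trans (setIntegral_mono_on (integrableOn_const (by simp))
    (integrable_cutoff_sq R).integrableOn measurableSet_Icc fun t ht => ?_)
    (setIntegral_le_integral (integrable_cutoff_sq R) (.of_forall fun t => sq_nonneg _))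
  rw [cutoff, Real.smoothTransition.one_of_one_le (by linarith [ht.2]),
    Real.smoothTransition.one_of_one_le (by linarith [ht.1])]
  norm_num

theorem integral_cutoff_sq_le {R : ℝ} (hR : 1 ≤ R) : ∫ t, cutoff R t ^ 2 ≤ R := by
  have h1 : ∫ _ in Icc (-R / 2) (R / 2), (1 : ℝ) = R := by
    rw [setIntegral_const, Real.volume_real_Icc_of_le (by linarith)]
    simp
    ring
  rw [← setIntegral_eq_integral_of_forall_compl_eq_zero (s := Icc (-R / 2) (R / 2))]
  · conv_rhs => rw [← h1]
    refine setIntegral_mono_on (integrable_cutoff_sq R).integrableOn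
      (integrableOn_const (by simp)) measurableSet_Icc fun t _ => ?_
    exact pow_le_one₀ (cutoff_nonneg R t) (cutoff_le_one R t)
  · intro t ht
    have h0 : cutoff R t = 0 := image_eq_zero_of_notMem_tsupport fun h => ht <| by
      have := tsupport_cutoff_subset R h
      exact ⟨by linarith [this.1], by linarith [this.2]⟩
    rw [h0, zero_pow two_ne_zero]

theorem integrable_deriv_smoothTransition_sq :
    Integrable (fun t => deriv Real.smoothTransition t ^ 2) := by
  refine Continuous.integrable_of_hasCompactSupport
    (((Real.smoothTransition.contDiff (n := 1)).continuous_deriv le_rfl).pow 2)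
    (HasCompactSupport.intro (isCompact_Icc (a := (0 : ℝ)) (b := 1)) fun t ht => ?_)
  rw [mem_Icc, not_and_or, not_le, not_le] at ht
  have : deriv Real.smoothTransition t = 0 := by
    rcases ht with h | h
    · have : Real.smoothTransition =ᶠ[nhds t] fun _ => 0 := by
        filter_upwards [eventually_lt_nhds h] with s hs
        exact Real.smoothTransition.zero_of_nonpos hs.le
      rw [this.deriv_eq, deriv_const]
    · have : Real.smoothTransition =ᶠ[nhds t] fun _ => 1 := by
        filter_upwards [eventually_gt_nhds h] with s hs
        exact Real.smoothTransition.one_of_one_le hs.le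
      rw [this.deriv_eq, deriv_const]
  rw [this, zero_pow two_ne_zero]

/-- The Dirichlet energy of the cutoff is bounded independently of `R`. -/
theorem integral_deriv_cutoff_sq_le (R : ℝ) :
    ∫ t, deriv (cutoff R) t ^ 2 ≤ 4 * ∫ t, deriv Real.smoothTransition t ^ 2 := by
  set c := R / 2 - 1 / 2 with hc
  set S := Real.smoothTransition with hS
  have hd : ∀ t, HasDerivAt S (deriv S t) t := fun t =>
    ((Real.smoothTransition.contDiff (n := 1)).differentiable one_ne_zero t).hasDerivAt
  have h1 : ∀ t, deriv (cutoff R) t =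
      -deriv S (c - t) * S (t + c) + S (c - t) * deriv S (t + c) := fun t => by
    have h := ((hd (c - t)).comp_const_sub c t).mul ((hd (t + c)).comp_add_const t c)
    exact h.deriv
  have h2 : ∀ t, deriv (cutoff R) t ^ 2 ≤
      2 * deriv S (c - t) ^ 2 + 2 * deriv S (t + c) ^ 2 := fun t => by
    have p1 : (deriv S (c - t) * S (t + c)) ^ 2 ≤ deriv S (c - t) ^ 2 := by
      rw [mul_pow]
      exact mul_le_of_le_one_right (sq_nonneg _)
        (pow_le_one₀ (Real.smoothTransition.nonneg _) (Real.smoothTransition.le_one _))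
    have p2 : (S (c - t) * deriv S (t + c)) ^ 2 ≤ deriv S (t + c) ^ 2 := by
      rw [mul_pow]
      exact mul_le_of_le_one_left (sq_nonneg _)
        (pow_le_one₀ (Real.smoothTransition.nonneg _) (Real.smoothTransition.le_one _))
    rw [h1]
    nlinarith [sq_nonneg (deriv S (c - t) * S (t + c) + S (c - t) * deriv S (t + c))]
  have hi := integrable_deriv_smoothTransition_sq
  have i1 : Integrable fun t => 2 * deriv S (c - t) ^ 2 := (hi.comp_sub_left c).const_mul 2
  have i2 : Integrable fun t => 2 * deriv S (t + c) ^ 2 := (hi.comp_add_right c).const_mul 2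
  refine (integral_mono (integrable_deriv_cutoff_sq R) (i1.add i2) h2).trans_eq ?_
  rw [integral_add' i1 i2, integral_const_mul, integral_const_mul,
    integral_sub_left_eq_self (fun t => deriv S t ^ 2) volume c,
    integral_add_right_eq_self (fun t => deriv S t ^ 2) c]
  ring

end Cutoff

section Spatial

variable {b R : ℝ}

theorem hasCompactSupport_of_tsupport_subset_QR {u : ℝ × ℝ × ℝ → ℂ} (hu : tsupport u ⊆ QR R) :
    HasCompactSupport u :=
  (isCompact_Icc.prod (isCompact_Icc.prod isCompact_Icc)).of_isClosed_subset
    (isClosed_tsupport u)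
    (hu.trans (prod_mono Ioo_subset_Icc_self (prod_mono Ioo_subset_Icc_self Ioo_subset_Icc_self)))

theorem integrable_comp_prodAssoc {f : ℝ × ℝ × ℝ → ℝ} (hf : Integrable f) :
    Integrable fun z : (ℝ × ℝ) × ℝ => f (z.1.1, z.1.2, z.2) :=
  (volume_preserving_prodAssoc (α₁ := ℝ) (β₁ := ℝ) (γ₁ := ℝ)).integrable_comp_of_integrable hf

theorem integral_eq_integral_integral_slice {f : ℝ × ℝ × ℝ → ℝ} (hf : Integrable f) :
    ∫ x, f x = ∫ t : ℝ, ∫ y : ℝ × ℝ, f (y.1, y.2, t) := by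
  rw [← (volume_preserving_prodAssoc (α₁ := ℝ) (β₁ := ℝ) (γ₁ := ℝ)).integral_comp'
    (f := MeasurableEquiv.prodAssoc) f]
  exact integral_prod_symm _ (integrable_comp_prodAssoc hf)

theorem fderiv_slice {u : ℝ × ℝ × ℝ → ℂ} (hu : Differentiable ℝ u) (t : ℝ) (y v : ℝ × ℝ) :
    fderiv ℝ (fun y : ℝ × ℝ => u (y.1, y.2, t)) y v =
      fderiv ℝ u (y.1, y.2, t) (v.1, v.2, 0) := by
  have h1 : HasFDerivAt (fun y : ℝ × ℝ => (y.1, y.2, t))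
      ((ContinuousLinearMap.fst ℝ ℝ ℝ).prod ((ContinuousLinearMap.snd ℝ ℝ ℝ).prod 0)) y :=
    hasFDerivAt_fst.prodMk (hasFDerivAt_snd.prodMk (hasFDerivAt_const t y))
  have h2 : HasFDerivAt (fun y : ℝ × ℝ => u (y.1, y.2, t)) _ y :=
    (hu (y.1, y.2, t)).hasFDerivAt.comp y h1
  rw [h2.fderiv]
  simp

theorem dens2_slice_le (hb : 0 ≤ b) {u : ℝ × ℝ × ℝ → ℂ} (hu : Differentiable ℝ u) (t : ℝ)
    (y : ℝ × ℝ) : dens2 b (fun y : ℝ × ℝ => u (y.1, y.2, t)) y ≤ dens3 b u (y.1, y.2, t) := by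
  have e1 : D1 (fun y : ℝ × ℝ => u (y.1, y.2, t)) y = DD1 u (y.1, y.2, t) := by
    rw [D1, DD1, fderiv_slice hu]; rfl
  have e2 : D2 (fun y : ℝ × ℝ => u (y.1, y.2, t)) y = DD2 u (y.1, y.2, t) := by
    rw [D2, DD2, fderiv_slice hu]; rfl
  have : 0 ≤ b * ‖DD3 u (y.1, y.2, t)‖ ^ 2 := by positivity
  rw [dens2, dens3, e1, e2]
  linarith

theorem tsupport_slice_subset (u : ℝ × ℝ × ℝ → ℂ) (t : ℝ) :
    tsupport (fun y : ℝ × ℝ => u (y.1, y.2, t)) ⊆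
      (fun y : ℝ × ℝ => (y.1, y.2, t)) ⁻¹' tsupport u :=
  closure_minimal (fun _ hx => subset_closure hx) ((isClosed_tsupport u).preimage (by fun_prop))

/-- Slicing bounds the three-dimensional energy from below by the two-dimensional one. -/
theorem mul_m0_le_G3 (hb : 0 ≤ b) (hR : 0 ≤ R) {u : ℝ × ℝ × ℝ → ℂ}
    (hu : ContDiff ℝ (⊤ : ℕ∞) u) (hs : tsupport u ⊆ QR R) : R * m0 b R ≤ G3 b R u := by
  have hdu : Differentiable ℝ u := hu.differentiable (by simp)
  have hdens := integrable_dens3 (b := b) hu (hasCompactSupport_of_tsupport_subset_QR hs)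
  have hdens' := integrable_comp_prodAssoc hdens
  have houter : Integrable fun t : ℝ => ∫ y : ℝ × ℝ, dens3 b u (y.1, y.2, t) :=
    hdens'.integral_prod_right
  have hslice : ∀ t : ℝ, m0 b R ≤ ∫ y : ℝ × ℝ, dens3 b u (y.1, y.2, t) := fun t => by
    have hud : ContDiff ℝ (⊤ : ℕ∞) (fun y : ℝ × ℝ => u (y.1, y.2, t)) :=
      hu.comp (contDiff_fst.prodMk (contDiff_snd.prodMk contDiff_const))
    have hus : tsupport (fun y : ℝ × ℝ => u (y.1, y.2, t)) ⊆ KR R := fun y hy => by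
      have := hs (tsupport_slice_subset u t hy)
      exact ⟨this.1, this.2.1⟩
    refine (m0_le hb hR hud hus).trans (integral_mono
      (integrable_dens2 hud (hasCompactSupport_of_tsupport_subset_KR hus)) ?_
      (dens2_slice_le hb hdu t))
    refine Continuous.integrable_of_hasCompactSupport ?_ (HasCompactSupport.intro
      (isCompact_Icc.prod isCompact_Icc : IsCompact (Icc (-R / 2) (R / 2) ×ˢ Icc (-R / 2) (R / 2)))
      fun y hy => dens3_eq_zero fun h => hy ?_)
    · have h0 := hu.continuous
      have h1 : Continuous (fderiv ℝ u) := hu.continuous_fderiv (by simp)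
      unfold dens3 DD1 DD2 DD3 Fpot
      fun_prop
    · have := hs h
      exact ⟨Ioo_subset_Icc_self this.1, Ioo_subset_Icc_self this.2.1⟩
  rw [G3_eq_integral hs, integral_eq_integral_integral_slice hdens,
    ← setIntegral_eq_integral_of_forall_compl_eq_zero (s := Ioo (-R / 2) (R / 2))]
  · have h1 : ∫ _ in Ioo (-R / 2) (R / 2), m0 b R = R * m0 b R := by
      rw [setIntegral_const, Real.volume_real_Ioo_of_le (by linarith), smul_eq_mul]
      ring
    rw [← h1]
    exact integral_mono (integrableOn_const (by simp)) houter.integrableOn hslice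
  · intro t ht
    have h0 : ∀ y : ℝ × ℝ, dens3 b u (y.1, y.2, t) = 0 := fun y =>
      dens3_eq_zero fun h => ht (hs h).2.2
    simp only [h0, integral_zero]

theorem mul_m0_le_M0 (hb : 0 ≤ b) (hR : 0 ≤ R) : R * m0 b R ≤ M0 b R := by
  refine le_csInf ⟨_, 0, contDiff_const, HasCompactSupport.zero, by simp [tsupport], rfl⟩ ?_
  rintro _ ⟨u, hu, -, hs, rfl⟩
  exact mul_m0_le_G3 hb hR hu hs

theorem M0_le (hb : 0 ≤ b) (hR : 0 ≤ R) {u : ℝ × ℝ × ℝ → ℂ} (hu : ContDiff ℝ (⊤ : ℕ∞) u)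
    (hs : tsupport u ⊆ QR R) : M0 b R ≤ ∫ x, dens3 b u x := by
  refine csInf_le ⟨R * m0 b R, ?_⟩
    ⟨u, hu, hasCompactSupport_of_tsupport_subset_QR hs, hs, (G3_eq_integral hs).symm⟩
  rintro _ ⟨u, hu, -, hs, rfl⟩
  exact mul_m0_le_G3 hb hR hu hs

theorem fderiv_prod_mul {v : ℝ × ℝ → ℂ} {f : ℝ → ℝ} (hv : Differentiable ℝ v)
    (hf : Differentiable ℝ f) (x w : ℝ × ℝ × ℝ) :
    fderiv ℝ (fun x : ℝ × ℝ × ℝ => (f x.2.2 : ℂ) * v (x.1, x.2.1)) x w =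
      (f x.2.2 : ℂ) * fderiv ℝ v (x.1, x.2.1) (w.1, w.2.1) +
        ((deriv f x.2.2 * w.2.2 : ℝ) : ℂ) * v (x.1, x.2.1) := by
  have p0 : HasFDerivAt (fun x : ℝ × ℝ × ℝ => x.2) (ContinuousLinearMap.snd ℝ ℝ (ℝ × ℝ)) x :=
    hasFDerivAt_snd
  have p1 : HasFDerivAt (fun x : ℝ × ℝ × ℝ => x.2.1) _ x := p0.fst
  have p2 : HasFDerivAt (fun x : ℝ × ℝ × ℝ => x.2.2) _ x := p0.snd
  have h1 : HasFDerivAt (fun x : ℝ × ℝ × ℝ => v (x.1, x.2.1)) _ x :=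
    (hv (x.1, x.2.1)).hasFDerivAt.comp x (hasFDerivAt_fst.prodMk p1)
  have h2 : HasFDerivAt (fun x : ℝ × ℝ × ℝ => (f x.2.2 : ℂ)) _ x :=
    Complex.ofRealCLM.hasFDerivAt.comp x ((hf x.2.2).hasDerivAt.hasFDerivAt.comp x p2)
  have h3 : HasFDerivAt (fun x : ℝ × ℝ × ℝ => (f x.2.2 : ℂ) * v (x.1, x.2.1)) _ x := h2.mul h1
  rw [h3.fderiv]
  simp
  ring

theorem dens3_prod_mul_le {v : ℝ × ℝ → ℂ} {f : ℝ → ℝ} (hv : Differentiable ℝ v)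
    (hf : Differentiable ℝ f) (h0 : ∀ t, 0 ≤ f t) (h1 : ∀ t, f t ≤ 1) (t : ℝ) (y : ℝ × ℝ) :
    dens3 b (fun x : ℝ × ℝ × ℝ => (f x.2.2 : ℂ) * v (x.1, x.2.1)) (y.1, y.2, t) ≤
      f t ^ 2 * dens2 b v y + b * (deriv f t ^ 2 * ‖v y‖ ^ 2) := by
  set u : ℝ × ℝ × ℝ → ℂ := fun x => (f x.2.2 : ℂ) * v (x.1, x.2.1) with hu
  have e1 : DD1 u (y.1, y.2, t) = (f t : ℂ) * D1 v y := by
    rw [DD1, hu, fderiv_prod_mul hv hf, D1]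
    simp [Fpot, A0]
    ring
  have e2 : DD2 u (y.1, y.2, t) = (f t : ℂ) * D2 v y := by
    rw [DD2, hu, fderiv_prod_mul hv hf, D2]
    simp [Fpot, A0]
    ring
  have e3 : DD3 u (y.1, y.2, t) = ((deriv f t : ℝ) : ℂ) * v y := by
    have hz : fderiv ℝ v y (0, 0) = 0 := map_zero _
    rw [DD3, hu, fderiv_prod_mul hv hf]
    simp [Fpot, hz]
  have e4 : u (y.1, y.2, t) = (f t : ℂ) * v y := rfl
  rw [dens3, e1, e2, e3, e4, dens2]
  simp only [norm_mul, Complex.norm_real, mul_pow, Real.norm_eq_abs, sq_abs]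
  have h4 : |f t| ^ 4 ≤ f t ^ 2 := by
    rw [abs_of_nonneg (h0 t)]
    exact pow_le_pow_of_le_one (h0 t) (h1 t) (by norm_num)
  have := mul_le_mul_of_nonneg_right h4 (by positivity : 0 ≤ ‖v y‖ ^ 4)
  nlinarith

/-- The three-dimensional energy is bounded above by trial states in product form. -/
theorem M0_le_add (hb : 0 ≤ b) (hR : 3 ≤ R) :
    M0 b R ≤ (R - 3) * m0 b R + R +
      b * ((4 * ∫ t, deriv Real.smoothTransition t ^ 2) * (1 + 2 * R ^ 2)) := by
  have hR0 : 0 ≤ R := by linarith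
  obtain ⟨v, hv, hvs, hE⟩ := exists_energy_lt_m0_add (b := b) (R := R) one_pos
  have hvc := hasCompactSupport_of_tsupport_subset_KR hvs
  have hdv : Differentiable ℝ v := hv.differentiable (by simp)
  have hχ := contDiff_cutoff R
  have hdχ : Differentiable ℝ (cutoff R) := hχ.differentiable (by simp)
  set u : ℝ × ℝ × ℝ → ℂ := fun x => (cutoff R x.2.2 : ℂ) * v (x.1, x.2.1) with hu
  have hud : ContDiff ℝ (⊤ : ℕ∞) u :=
    (Complex.ofRealCLM.contDiff.comp (hχ.comp (contDiff_snd.comp contDiff_snd))).mul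
      (hv.comp (contDiff_fst.prodMk (contDiff_fst.comp contDiff_snd)))
  have hus : tsupport u ⊆ QR R := by
    have h : tsupport u ⊆ (fun x : ℝ × ℝ × ℝ => (x.1, x.2.1)) ⁻¹' tsupport v ∩
        (fun x : ℝ × ℝ × ℝ => x.2.2) ⁻¹' tsupport (cutoff R) := by
      refine closure_minimal (fun x hx => ⟨subset_closure ?_, subset_closure ?_⟩)
        (((isClosed_tsupport v).preimage (by fun_prop)).inter
          ((isClosed_tsupport (cutoff R)).preimage (by fun_prop)))
      · exact right_ne_zero_of_mul (Function.mem_support.mp hx)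
      · exact Complex.ofReal_ne_zero.mp (left_ne_zero_of_mul (Function.mem_support.mp hx))
    intro x hx
    obtain ⟨h1, h2⟩ := h hx
    have h1 := hvs h1
    have h2 := tsupport_cutoff_subset R h2
    exact ⟨h1.1, h1.2, by linarith [h2.1], by linarith [h2.2]⟩
  have hdens := integrable_dens3 (b := b) hud (hasCompactSupport_of_tsupport_subset_QR hus)
  have i2 : Integrable (fun x => ‖v x‖ ^ 2) := by
    refine Continuous.integrable_of_hasCompactSupport (by have := hv.continuous; fun_prop)
      (HasCompactSupport.intro hvc fun x hx => ?_)
    simp [image_eq_zero_of_notMem_tsupport hx]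
  have hL2 := integral_sq_norm_le hb hR0 hv hvs
  rw [G2_eq_integral hvs] at hL2
  have hm := m0_nonpos hb hR0
  set I := ∫ y, dens2 b v y with hI
  set N := ∫ y, ‖v y‖ ^ 2 with hN
  have hN0 : 0 ≤ N := integral_nonneg fun _ => by positivity
  set A := ∫ t, cutoff R t ^ 2 with hA
  set B := ∫ t, deriv (cutoff R) t ^ 2 with hB
  have hB0 : 0 ≤ B := integral_nonneg fun _ => by positivity
  have hA1 : R - 3 ≤ A := le_integral_cutoff_sq hR
  have hA2 : A ≤ R := integral_cutoff_sq_le (by linarith)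
  have hB1 := integral_deriv_cutoff_sq_le R
  rw [← hB] at hB1
  have hE3 : ∫ x, dens3 b u x ≤ A * I + b * (B * N) := by
    have j1 : Integrable fun z : ℝ × (ℝ × ℝ) => cutoff R z.1 ^ 2 * dens2 b v z.2 :=
      (integrable_cutoff_sq R).mul_prod (integrable_dens2 hv hvc)
    have j2 : Integrable fun z : ℝ × (ℝ × ℝ) => b * (deriv (cutoff R) z.1 ^ 2 * ‖v z.2‖ ^ 2) :=
      ((integrable_deriv_cutoff_sq R).mul_prod i2).const_mul b
    have h1 : ∫ x, dens3 b u x =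
        ∫ z : ℝ × (ℝ × ℝ), dens3 b u (z.2.1, z.2.2, z.1) := by
      rw [integral_eq_integral_integral_slice hdens]
      exact (integral_prod _ (integrable_comp_prodAssoc hdens).swap).symm
    rw [h1]
    refine (integral_mono (integrable_comp_prodAssoc hdens).swap (j1.add j2) fun z =>
      dens3_prod_mul_le hdv hdχ (cutoff_nonneg R) (cutoff_le_one R) z.1 z.2).trans_eq ?_
    refine (integral_add' j1 j2).trans ?_
    rw [integral_const_mul]
    congr 1
    · exact integral_prod_mul (fun t => cutoff R t ^ 2) (dens2 b v)
    · congr 1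
      exact integral_prod_mul (fun t => deriv (cutoff R) t ^ 2) (fun y => ‖v y‖ ^ 2)
  refine (M0_le hb hR0 hud hus).trans (hE3.trans ?_)
  have k1 : A * I ≤ (R - 3) * m0 b R + R := by
    have : A * I ≤ A * (m0 b R + 1) := mul_le_mul_of_nonneg_left hE.le (by linarith)
    have := mul_le_mul_of_nonpos_right hA1 hm
    linarith
  have k2 : B * N ≤ (4 * ∫ t, deriv Real.smoothTransition t ^ 2) * (1 + 2 * R ^ 2) :=
    mul_le_mul hB1 (by linarith) hN0 (hB0.trans hB1)
  have := mul_le_mul_of_nonneg_left k2 hb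
  linarith

end Spatial

/-- The 3D thermodynamic limit coincides with the 2D one: `M₀(b,R)/R³ → g(b)`. -/
theorem stmt_18 (b : ℝ) (hb0 : 0 < b) (hb1 : b < 1) :
    Tendsto (fun R : ℝ => M0 b R / R ^ 3) atTop (nhds (gfun b)) := by
  have hlim := tendsto_m0_div hb0.le
  set C := 4 * ∫ t, deriv Real.smoothTransition t ^ 2
  have hinv : Tendsto (fun R : ℝ => R⁻¹) atTop (nhds 0) := tendsto_inv_atTop_zero
  have hupper : Tendsto (fun R : ℝ => (1 - 3 * R⁻¹) * (m0 b R / R ^ 2) + R⁻¹ ^ 2 +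
      b * (C * (R⁻¹ ^ 3 + 2 * R⁻¹))) atTop (nhds (gfun b)) := by
    have h := (((tendsto_const_nhds (x := (1 : ℝ))).sub (hinv.const_mul 3)).mul hlim).add
      (hinv.pow 2) |>.add ((((hinv.pow 3).add (hinv.const_mul 2)).const_mul C).const_mul b)
    simpa using h
  refine tendsto_of_tendsto_of_tendsto_of_le_of_le' hlim hupper ?_ ?_
  · filter_upwards [eventually_gt_atTop 0] with R hR
    rw [div_le_div_iff₀ (by positivity) (by positivity)]
    have := mul_le_mul_of_nonneg_right (mul_m0_le_M0 hb0.le hR.le) (sq_nonneg R)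
    linarith
  · filter_upwards [eventually_ge_atTop 3] with R hR
    have hR0 : 0 < R := by linarith
    rw [div_le_iff₀ (by positivity)]
    refine (M0_le_add hb0.le hR).trans_eq ?_
    change (R - 3) * m0 b R + R + b * (C * (1 + 2 * R ^ 2)) = _
    field_simp
end

section
/- Let R > 0 satisfy R² = 2πN for some positive integer N. Then the set of smooth functions u : ℝ² → ℂ satisfying the magnetic periodicity conditions u(x₁+R, x₂) = e^{iRx₂/2} u(x₁,x₂), u(x₁, x₂+R) = e^{−iRx₁/2} u(x₁,x₂), together with the lowest Landau band equation (∂_{x₁} + i ∂_{x₂} + (1/2)(x₁ + i x₂)) u = 0 on ℝ², forms a complex vector space of dimension exactly N = R²/(2π). -/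
open MeasureTheory Filter Set

section ThetaFunctions

open Complex

/-- Entire functions `h` with `h (w + 1) = h w` and `h (w + i) = exp (πN - 2πiNw) h w`. -/
def thetaSpace (N : ℕ) : Submodule ℂ (ℂ → ℂ) where
  carrier := {h | Differentiable ℂ h ∧ (∀ w, h (w + 1) = h w) ∧
    ∀ w, h (w + I) = exp (Real.pi * N - 2 * Real.pi * I * N * w) * h w}
  add_mem' := by
    rintro f g ⟨hf, hf1, hfI⟩ ⟨hg, hg1, hgI⟩
    refine ⟨hf.add hg, fun w => ?_, fun w => ?_⟩
    · simp [hf1, hg1]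
    · simp [hfI, hgI, mul_add]
  zero_mem' := ⟨differentiable_const 0, by simp, by simp⟩
  smul_mem' := by
    rintro c f ⟨hf, hf1, hfI⟩
    refine ⟨hf.const_smul c, fun w => ?_, fun w => ?_⟩
    · simp [hf1]
    · simp [hfI, mul_left_comm]

/-- The `n`-th Fourier coefficient along the unit interval. -/
noncomputable def thetaCoeff (h : ℂ → ℂ) (n : ℤ) : ℂ :=
  ∫ x : ℝ in (0 : ℝ)..1, exp (-(2 * Real.pi * I * n * x)) * h x

lemma thetaCoeff_add_period {N : ℕ} {h : ℂ → ℂ} (hh : h ∈ thetaSpace N) (n : ℤ) :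
    thetaCoeff h n = exp (Real.pi * N + 2 * Real.pi * n) * thetaCoeff h (n + N) := by
  obtain ⟨hd, h1, hI⟩ := hh
  have key := integral_boundary_rect_eq_zero_of_differentiableOn
    (fun z => exp (-(2 * Real.pi * I * n * z)) * h z) 0 (1 + I)
    (by fun_prop)
  have hside : ∀ y : ℝ, exp (-(2 * Real.pi * I * n * (1 + y * I))) * h (1 + y * I) =
      exp (-(2 * Real.pi * I * n * (y * I))) * h (y * I) := fun y => by
    rw [add_comm (1 : ℂ), h1]
    congr 1
    rw [exp_eq_exp_iff_exists_int]
    exact ⟨-n, by push_cast; ring⟩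
  have htop : ∀ x : ℝ, exp (-(2 * Real.pi * I * n * (x + I))) * h (x + I) =
      exp (Real.pi * N + 2 * Real.pi * n) *
        (exp (-(2 * Real.pi * I * (n + N : ℤ) * x)) * h x) := fun x => by
    rw [hI, ← mul_assoc, ← mul_assoc, ← exp_add, ← exp_add]
    congr 2
    push_cast
    linear_combination (-2 * Real.pi * n : ℂ) * I_sq
  simp [hside, htop] at key
  simpa [thetaCoeff] using sub_eq_zero.1 key

lemma thetaCoeff_eq_zero {N : ℕ} (hN : 0 < N) {h : ℂ → ℂ} (hh : h ∈ thetaSpace N)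
    (hc : ∀ k : Fin N, thetaCoeff h (k : ℕ) = 0) (n : ℤ) : thetaCoeff h n = 0 := by
  have hshift : ∀ n : ℤ, thetaCoeff h n = 0 ↔ thetaCoeff h (n + N) = 0 := fun n => by
    rw [thetaCoeff_add_period hh n]
    simp [exp_ne_zero]
  have hper : Function.Periodic (fun n : ℤ => thetaCoeff h n = 0) (N : ℤ) :=
    fun n => propext (hshift n).symm
  have hN' : (0 : ℤ) < N := by exact_mod_cast hN
  have hmod : (thetaCoeff h (n % N) = 0) = (thetaCoeff h n = 0) := by
    have := hper.sub_zsmul_eq (x := n) (n / N)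
    simpa [Int.emod_def, mul_comm] using this
  rw [← hmod]
  have hlt := Int.emod_lt_of_pos n hN'
  have hnn := Int.emod_nonneg n hN'.ne'
  have := hc ⟨(n % N).toNat, by omega⟩
  simpa [Int.toNat_of_nonneg hnn] using this

lemma eq_zero_of_thetaCoeff_eq_zero {h : ℂ → ℂ} (hd : Differentiable ℂ h)
    (h1 : ∀ w, h (w + 1) = h w) (hc : ∀ n, thetaCoeff h n = 0) : h = 0 := by
  have hper : Function.Periodic (fun x : ℝ => h x) 1 := fun x => by simp [h1]
  have hcont : Continuous (hper.lift : UnitAddCircle → ℂ) :=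
    continuous_coinduced_dom.mpr (hd.continuous.comp continuous_ofReal)
  obtain ⟨F, hF⟩ : ∃ F : C(UnitAddCircle, ℂ), ∀ x : ℝ, F x = h x :=
    ⟨⟨hper.lift, hcont⟩, fun x => hper.lift_coe x⟩
  have hfc : fourierCoeff F = 0 := by
    ext n
    rw [fourierCoeff_eq_intervalIntegral _ n 0]
    have hfourier : ∀ x : ℝ, fourier (-n) (x : UnitAddCircle) = exp (-(2 * Real.pi * I * n * x)) :=
      fun x => by
        rw [fourier_coe_apply]
        congr 1
        push_cast
        ring
    simp only [hfourier, hF]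
    simpa [thetaCoeff] using hc n
  have hsum := hasSum_fourier_series_of_summable (f := F) (by rw [hfc]; exact summable_zero)
  have hzero : F = 0 := hsum.unique (by
    rw [hfc]
    convert! hasSum_zero using 2 with n
    exact zero_smul ℂ (fourier n : C(UnitAddCircle, ℂ)))
  have hreal : ∀ x : ℝ, h x = 0 := fun x => by rw [← hF, hzero, ContinuousMap.zero_apply]
  refine AnalyticOnNhd.eq_of_frequently_eq (z₀ := 0)
    (fun z _ => hd.analyticAt z) (fun z _ => analyticAt_const) ?_
  have ht : Tendsto (fun x : ℝ => (x : ℂ)) (nhdsWithin 0 {0}ᶜ) (nhdsWithin 0 {0}ᶜ) := by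
    refine tendsto_nhdsWithin_iff.2 ⟨?_, ?_⟩
    · exact (continuous_ofReal.tendsto' 0 0 (by simp)).mono_left nhdsWithin_le_nhds
    · filter_upwards [self_mem_nhdsWithin] with x hx
      simpa using hx
  exact ht.frequently (Eventually.of_forall hreal).frequently

/-- The first `N` Fourier coefficients, as a linear map on `thetaSpace N`. -/
noncomputable def thetaCoeffMap (N : ℕ) : thetaSpace N →ₗ[ℂ] (Fin N → ℂ) where
  toFun h k := thetaCoeff h (k : ℕ)
  map_add' f g := by
    ext k
    have hf : Continuous (f : ℂ → ℂ) := f.2.1.continuous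
    have hg : Continuous (g : ℂ → ℂ) := g.2.1.continuous
    simp only [thetaCoeff, Submodule.coe_add, Pi.add_apply, mul_add]
    apply intervalIntegral.integral_add <;>
    · apply Continuous.intervalIntegrable
      fun_prop
  map_smul' c f := by
    ext k
    simp [thetaCoeff, mul_left_comm]

lemma thetaCoeffMap_injective {N : ℕ} (hN : 0 < N) : Function.Injective (thetaCoeffMap N) := by
  rw [injective_iff_map_eq_zero]
  intro h hh
  exact Subtype.ext (eq_zero_of_thetaCoeff_eq_zero h.2.1 h.2.2.1
    (thetaCoeff_eq_zero hN h.2 fun k => congr_fun hh k))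

/-- The theta function `w ↦ exp (2πikw) ϑ(Nw + ik, iN)`. -/
noncomputable def thetaBasis (N k : ℕ) (w : ℂ) : ℂ :=
  exp (2 * Real.pi * I * k * w) * jacobiTheta₂ (N * w + I * k) (I * N)

lemma thetaBasis_mem {N : ℕ} (hN : 0 < N) (k : ℕ) : thetaBasis N k ∈ thetaSpace N := by
  refine ⟨fun w => ?_, fun w => ?_, fun w => ?_⟩
  · have hθ := differentiableAt_jacobiTheta₂_fst (N * w + I * k) (τ := I * N) (by simpa using hN)
    have hl : DifferentiableAt ℂ (fun w : ℂ => (N : ℂ) * w + I * k) w := by fun_prop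
    have hcomp := hθ.comp w hl
    unfold thetaBasis
    exact DifferentiableAt.mul (by fun_prop) hcomp
  · have hθ : ∀ (m : ℕ) (z : ℂ), jacobiTheta₂ (z + m) (I * N) = jacobiTheta₂ z (I * N) := by
      intro m z
      induction m with
      | zero => simp
      | succ m ih => rw [Nat.cast_succ, ← add_assoc, jacobiTheta₂_add_left, ih]
    unfold thetaBasis
    rw [show (N : ℂ) * (w + 1) + I * k = (N * w + I * k) + N by ring, hθ]
    congr 1
    rw [exp_eq_exp_iff_exists_int]
    exact ⟨k, by push_cast; ring⟩
  · unfold thetaBasis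
    rw [show (N : ℂ) * (w + I) + I * k = (N * w + I * k) + I * N by ring, jacobiTheta₂_add_left',
      ← mul_assoc, ← mul_assoc, ← exp_add, ← exp_add]
    congr 2
    linear_combination (-Real.pi * N : ℂ) * I_sq

lemma thetaBasis_translate {N : ℕ} (hN : 0 < N) (k : ℕ) (w : ℂ) :
    thetaBasis N k (w + 1 / N) = exp (2 * Real.pi * I / N) ^ k * thetaBasis N k w := by
  have hN' : (N : ℂ) ≠ 0 := by exact_mod_cast hN.ne'
  unfold thetaBasis
  rw [show (N : ℂ) * (w + 1 / N) + I * k = (N * w + I * k) + 1 by field_simp; ring,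
    jacobiTheta₂_add_left, ← exp_nat_mul, ← mul_assoc, ← exp_add]
  congr 2
  field_simp
  ring

lemma jacobiTheta₂_zero_ne_zero {t : ℝ} (ht : 0 < t) : jacobiTheta₂ 0 (I * t) ≠ 0 := by
  have hs := hasSum_jacobiTheta₂_term 0 (τ := I * t) (by simpa using ht)
  have hterm : ∀ n : ℤ, jacobiTheta₂_term n 0 (I * t) = (Real.exp (-Real.pi * n ^ 2 * t) : ℝ) := by
    intro n
    rw [jacobiTheta₂_term, ofReal_exp]
    congr 1
    push_cast
    linear_combination (Real.pi * n ^ 2 * t : ℂ) * I_sq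
  have hre := hasSum_re hs
  simp only [hterm, ofReal_re] at hre
  intro h0
  rw [h0] at hre
  have hle := le_hasSum hre 0 fun n _ => (Real.exp_pos _).le
  exact absurd hle (by simp)

lemma thetaBasis_ne_zero {N : ℕ} (hN : 0 < N) (k : ℕ) : thetaBasis N k ≠ 0 := by
  intro h
  have hN' : (N : ℂ) ≠ 0 := by exact_mod_cast hN.ne'
  have h0 := congr_fun h (-(I * k) / N)
  have hθ := jacobiTheta₂_zero_ne_zero (t := N) (by exact_mod_cast hN)
  have hz : (N : ℂ) * (-(I * k) / N) + I * k = 0 := by field_simp; ring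
  simp only [thetaBasis, hz, Pi.zero_apply, mul_eq_zero, exp_ne_zero, false_or] at h0
  exact hθ (by simpa using h0)

lemma linearIndependent_thetaBasis {N : ℕ} (hN : 0 < N) :
    LinearIndependent ℂ fun k : Fin N => thetaBasis N k := by
  refine Module.End.eigenvectors_linearIndependent'
    (LinearMap.funLeft ℂ ℂ fun w : ℂ => w + 1 / N)
    (fun k : Fin N => exp (2 * Real.pi * I / N) ^ (k : ℕ)) ?_ _ fun k => ?_
  · intro j k hjk
    exact Fin.ext ((isPrimitiveRoot_exp N hN.ne').pow_inj j.2 k.2 hjk)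
  · refine ⟨Module.End.mem_eigenspace_iff.2 ?_, thetaBasis_ne_zero hN k⟩
    ext w
    exact thetaBasis_translate hN k w

theorem finrank_thetaSpace {N : ℕ} (hN : 0 < N) : Module.finrank ℂ (thetaSpace N) = N := by
  have hinj := thetaCoeffMap_injective hN
  have : FiniteDimensional ℂ (thetaSpace N) := FiniteDimensional.of_injective _ hinj
  refine le_antisymm ?_ ?_
  · simpa using LinearMap.finrank_le_finrank_of_injective hinj
  · have hli : LinearIndependent ℂ
        fun k : Fin N => (⟨thetaBasis N k, thetaBasis_mem hN k⟩ : thetaSpace N) :=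
      LinearIndependent.of_comp (thetaSpace N).subtype (linearIndependent_thetaBasis hN)
    simpa using hli.fintype_card_le_finrank

end ThetaFunctions

section LandauGauge

open Complex

/-- The isomorphism sending `h` to `x ↦ exp (i x₂ z / 2) h (z / R)`, with `z = x₁ + i x₂`. -/
noncomputable def landauEquiv (R : ℝ) (hR : R ≠ 0) : (ℂ → ℂ) ≃ₗ[ℂ] (ℝ × ℝ → ℂ) where
  toFun h x := exp (I * x.2 * (x.1 + I * x.2) / 2) * h ((x.1 + I * x.2) / R)
  invFun u w := exp (-(I * R ^ 2 / 2 * w.im * w)) * u (R * w.re, R * w.im)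
  map_add' f g := by ext x; simp [mul_add]
  map_smul' c f := by ext x; simp [mul_left_comm]
  left_inv h := by
    have hR' : (R : ℂ) ≠ 0 := by exact_mod_cast hR
    ext w
    have hw : ((R * w.re : ℝ) + I * (R * w.im : ℝ) : ℂ) = R * w := by
      conv_rhs => rw [← re_add_im w]
      push_cast
      ring
    simp only [hw]
    rw [mul_div_cancel_left₀ _ hR', ← mul_assoc, ← exp_add]
    convert one_mul (h w)
    rw [exp_eq_one_iff]
    exact ⟨0, by push_cast; ring⟩
  right_inv u := by
    have hR' : (R : ℂ) ≠ 0 := by exact_mod_cast hR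
    ext x
    have hre : (((x.1 : ℂ) + I * x.2) / R).re = x.1 / R := by simp [div_ofReal_re]
    have him : (((x.1 : ℂ) + I * x.2) / R).im = x.2 / R := by simp [div_ofReal_im]
    simp only [hre, him, mul_div_cancel₀ _ hR]
    rw [← mul_assoc, ← exp_add]
    convert one_mul (u x)
    rw [exp_eq_one_iff]
    exact ⟨0, by push_cast; field_simp; ring⟩

lemma landauEquiv_apply {R : ℝ} (hR : R ≠ 0) (h : ℂ → ℂ) (x : ℝ × ℝ) :
    landauEquiv R hR h x =
      exp (I * x.2 * (x.1 + I * x.2) / 2) * h ((x.1 + I * x.2) / R) := rfl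

lemma landauEquiv_symm_apply {R : ℝ} (hR : R ≠ 0) (u : ℝ × ℝ → ℂ) (w : ℂ) :
    (landauEquiv R hR).symm u w =
      exp (-(I * R ^ 2 / 2 * w.im * w)) * u (R * w.re, R * w.im) := rfl

lemma differentiableAt_landauEquiv_symm_iff {R : ℝ} (hR : R ≠ 0) {u : ℝ × ℝ → ℂ}
    (hu : Differentiable ℝ u) (w : ℂ) :
    DifferentiableAt ℂ ((landauEquiv R hR).symm u) w ↔
      fderiv ℝ u (R * w.re, R * w.im) (1, 0) + I * fderiv ℝ u (R * w.re, R * w.im) (0, 1)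
        + (1 / 2 : ℂ) * ((R * w.re : ℝ) + I * (R * w.im : ℝ)) * u (R * w.re, R * w.im) = 0 := by
  have hR' : (R : ℂ) ≠ 0 := by exact_mod_cast hR
  have hphase : HasFDerivAt (fun w : ℂ => -(I * R ^ 2 / 2 * w.im * w))
      (-((I * R ^ 2 / 2 * w.im) • ContinuousLinearMap.id ℝ ℂ +
        w • ((I * R ^ 2 / 2) • (ofRealCLM.comp imCLM)))) w := by
    have him : HasFDerivAt (fun w : ℂ => (w.im : ℂ)) (ofRealCLM.comp imCLM) w :=
      (ofRealCLM.comp imCLM).hasFDerivAt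
    exact ((him.const_mul (I * (R : ℂ) ^ 2 / 2)).mul (hasFDerivAt_id w)).neg
  have hlin : HasFDerivAt (fun w : ℂ => ((R * w.re, R * w.im) : ℝ × ℝ))
      ((R • reCLM).prod (R • imCLM)) w := ((R • reCLM).prod (R • imCLM)).hasFDerivAt
  have hcomp := (hu (R * w.re, R * w.im)).hasFDerivAt.comp w hlin
  have hprod := hphase.cexp.mul hcomp
  have hsymm : HasFDerivAt ((landauEquiv R hR).symm u) _ w := hprod
  rw [differentiableAt_complex_iff_differentiableAt_real, hsymm.fderiv]
  have h1 : fderiv ℝ u (R * w.re, R * w.im) (R, 0) =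
      R * fderiv ℝ u (R * w.re, R * w.im) (1, 0) := by
    rw [← real_smul, ← map_smul]
    simp
  have h2 : fderiv ℝ u (R * w.re, R * w.im) (0, R) =
      R * fderiv ℝ u (R * w.re, R * w.im) (0, 1) := by
    rw [← real_smul, ← map_smul]
    simp
  have hw : ((R * w.re : ℝ) + I * (R * w.im : ℝ) : ℂ) = R * w := by
    conv_rhs => rw [← re_add_im w]
    push_cast
    ring
  rw [hw]
  simp only [hsymm.differentiableAt, true_and]
  simp [h1, h2]
  set e := exp (-(I * R ^ 2 / 2 * w.im * w))
  have he : e ≠ 0 := exp_ne_zero _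
  set d1 := fderiv ℝ u (R * w.re, R * w.im) (1, 0)
  set d2 := fderiv ℝ u (R * w.re, R * w.im) (0, 1)
  set v := u (R * w.re, R * w.im)
  rw [← sub_eq_zero]
  have hne : -(I * R * e) ≠ 0 := by simp [hR', he, I_ne_zero]
  rw [← mul_eq_zero_iff_left hne (b := d1 + _ + _)]
  refine Eq.congr_left ?_
  linear_combination (e * R * d2) * I_sq

lemma differentiable_iff_landauEquiv {R : ℝ} (hR : R ≠ 0) (h : ℂ → ℂ) :
    Differentiable ℂ h ↔
      ContDiff ℝ (⊤ : ℕ∞) (landauEquiv R hR h) ∧ LLL (landauEquiv R hR h) := by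
  have key := fun hu => differentiableAt_landauEquiv_symm_iff hR (u := landauEquiv R hR h) hu
  simp only [LinearEquiv.symm_apply_apply] at key
  constructor
  · intro hh
    have hsmooth : ContDiff ℝ (⊤ : ℕ∞) (landauEquiv R hR h) := by
      have h1 : ContDiff ℝ (⊤ : ℕ∞) h := hh.contDiff.restrict_scalars ℝ
      have h2 : ContDiff ℝ (⊤ : ℕ∞) fun x : ℝ × ℝ => (x.1 : ℂ) :=
        ofRealCLM.contDiff.comp contDiff_fst
      have h3 : ContDiff ℝ (⊤ : ℕ∞) fun x : ℝ × ℝ => (x.2 : ℂ) :=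
        ofRealCLM.contDiff.comp contDiff_snd
      change ContDiff ℝ (⊤ : ℕ∞) fun x : ℝ × ℝ =>
        exp (I * x.2 * (x.1 + I * x.2) / 2) * h ((x.1 + I * x.2) / R)
      fun_prop
    refine ⟨hsmooth, fun x => ?_⟩
    have hx := (key (hsmooth.differentiable (by simp)) ⟨x.1 / R, x.2 / R⟩).1 (hh _)
    simpa only [mul_div_cancel₀ _ hR] using hx
  · rintro ⟨hsmooth, hL⟩ w
    exact (key (hsmooth.differentiable (by simp)) w).2 (hL _)

lemma magPeriodic_landauEquiv_iff {R : ℝ} (hR : R ≠ 0) {N : ℕ} (hN : R ^ 2 = 2 * Real.pi * N)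
    (h : ℂ → ℂ) :
    MagPeriodic R (landauEquiv R hR h) ↔ (∀ w, h (w + 1) = h w) ∧
      ∀ w, h (w + I) = exp (Real.pi * N - 2 * Real.pi * I * N * w) * h w := by
  have hR' : (R : ℂ) ≠ 0 := by exact_mod_cast hR
  have hN' : (R : ℂ) ^ 2 = 2 * Real.pi * N := by exact_mod_cast hN
  have hsurj : Function.Surjective fun x : ℝ × ℝ => ((x.1 : ℂ) + I * x.2) / R := fun w => by
    refine ⟨(R * w.re, R * w.im), ?_⟩
    rw [div_eq_iff hR']
    conv_rhs => rw [← re_add_im w]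
    push_cast
    ring
  rw [hsurj.forall, hsurj.forall, ← forall_and]
  refine forall_congr' fun x => and_congr ?_ ?_
  · simp only [landauEquiv_apply]
    rw [← mul_assoc, ← exp_add,
      show (((x.1 + R : ℝ) : ℂ) + I * x.2) / R = (x.1 + I * x.2) / R + 1 by
        push_cast; field_simp; ring,
      show I * (x.2 : ℂ) * (((x.1 + R : ℝ) : ℂ) + I * x.2) / 2 =
        I * (R * x.2 / 2) + I * x.2 * (x.1 + I * x.2) / 2 by push_cast; ring]
    exact mul_right_inj' (exp_ne_zero _)
  · simp only [landauEquiv_apply]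
    rw [← mul_assoc, ← exp_add,
      show ((x.1 : ℂ) + I * ((x.2 + R : ℝ) : ℂ)) / R = (x.1 + I * x.2) / R + I by
        push_cast; field_simp; ring,
      show -(I * (R * (x.1 : ℂ) / 2)) + I * x.2 * (x.1 + I * x.2) / 2 =
        I * ((x.2 + R : ℝ) : ℂ) * (x.1 + I * ((x.2 + R : ℝ) : ℂ)) / 2 +
          (Real.pi * N - 2 * Real.pi * I * N * ((x.1 + I * x.2) / R)) by
        rw [show (2 * Real.pi * I * N * ((x.1 + I * x.2) / R) : ℂ) = I * R * (x.1 + I * x.2) by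
          rw [show (2 * Real.pi * I * N * ((x.1 + I * x.2) / R) : ℂ) =
            I * (2 * Real.pi * N) * ((x.1 + I * x.2) / R) by ring, ← hN']
          field_simp,
          show (Real.pi * N : ℂ) = R ^ 2 / 2 by rw [hN']; ring]
        push_cast
        linear_combination (-(R : ℂ) ^ 2 / 2) * I_sq,
      exp_add (_ / 2), mul_assoc (exp (_ / 2))]
    exact mul_right_inj' (exp_ne_zero _)

end LandauGauge

/-- The lowest Landau band of magnetic periodic functions is a complex vector space of
dimension `N = R²/(2π)`. -/
theorem stmt_19 (R : ℝ) (N : ℕ) (hN : 0 < N) (hR : R ^ 2 = 2 * Real.pi * N) :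
    ∃ W : Submodule ℂ (ℝ × ℝ → ℂ),
      (W : Set (ℝ × ℝ → ℂ)) = {u | ContDiff ℝ (⊤ : ℕ∞) u ∧ MagPeriodic R u ∧ LLL u} ∧
      Module.finrank ℂ W = N := by
  have hR0 : R ≠ 0 := by
    rintro rfl
    have : (0 : ℝ) < 2 * Real.pi * N := by positivity
    norm_num [← hR] at this
  refine ⟨(thetaSpace N).map (landauEquiv R hR0 : (ℂ → ℂ) →ₗ[ℂ] (ℝ × ℝ → ℂ)), ?_, ?_⟩
  · ext u
    obtain ⟨h, rfl⟩ := (landauEquiv R hR0).surjective u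
    have hmem : landauEquiv R hR0 h ∈
        (thetaSpace N).map (landauEquiv R hR0 : (ℂ → ℂ) →ₗ[ℂ] (ℝ × ℝ → ℂ)) ↔
          h ∈ thetaSpace N := by simp
    rw [SetLike.mem_coe, hmem]
    change (Differentiable ℂ h ∧ _) ↔ _
    rw [differentiable_iff_landauEquiv hR0, ← magPeriodic_landauEquiv_iff hR0 hR]
    simp only [mem_ofPred_eq]
    tauto
  · rw [LinearEquiv.finrank_map_eq, finrank_thetaSpace hN]
end
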